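/- Let (χ_n) ⊂ IP(μ) be a sequence of admissible irrigation plans and (ε_n) positive numbers such that χ_n → χ ∈ IP(μ) and ε_n → 0 as n → ∞. Assume the stopping times satisfy ∫_Θ T_n(θ) dθ ≤ C for a uniform constant C > 0 and all n ≥ 1. Then for a.e. θ ∈ Θ and every t ∈ ℝ₊, the alternative mollified multiplicities satisfy limsup_{n→∞} W̃_{ε_n}(χ_n(θ,t), χ_n) ≤ |χ(θ,t)|_χ. -/

import Mathlib

open MeasureTheory Filter Topology
open scoped ENNReal NNReal

noncomputable section

/-- Euclidean space `ℝ^d`. -/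
abbrev Euc (d : ℕ) : Type := EuclideanSpace ℝ (Fin d)

/-- `Θ = [0, M]` where `M = μ(ℝ^d)` is the total mass. -/
def Theta {d : ℕ} (μ : Measure (Euc d)) : Set ℝ := Set.Icc 0 (μ Set.univ).toReal

/-- The stopping time `T(θ)` of a Lagrangian path. -/
def stopTime {d : ℕ} (χ : ℝ → ℝ → Euc d) (θ : ℝ) : ℝ :=
  sInf {t : ℝ | 0 < t ∧ ∀ t' ≥ t, χ θ t' = χ θ t}

/-- An admissible irrigation plan for the measure `μ`: measurable, `1`-Lipschitz and eventually
constant paths, all starting at the origin, whose final positions push the Lebesgue measure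
on `Θ = [0,M]` forward onto `μ`. -/
structure IsIrrigPlan {d : ℕ} (μ : Measure (Euc d)) (χ : ℝ → ℝ → Euc d) : Prop where
  measurable : Measurable (Function.uncurry χ)
  lipschitz : ∀ θ ∈ Theta μ, LipschitzWith 1 (χ θ)
  eventuallyConst : ∀ θ ∈ Theta μ, ∃ t, 0 < t ∧ ∀ t' ≥ t, χ θ t' = χ θ t
  init : ∀ θ ∈ Theta μ, χ θ 0 = 0
  pushforward :
    Measure.map (fun θ => χ θ (stopTime χ θ)) (volume.restrict (Theta μ)) = μ

/-- The multiplicity `|x|_χ`: the measure of the set of particles passing through `x`. -/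
def mult {d : ℕ} (μ : Measure (Euc d)) (χ : ℝ → ℝ → Euc d) (x : Euc d) : ℝ≥0∞ :=
  volume {θ ∈ Theta μ | ∃ t, 0 ≤ t ∧ χ θ t = x}

/-- The `α`-irrigation cost `E^α(χ)`. -/
def irrCost {d : ℕ} (μ : Measure (Euc d)) (α : ℝ) (χ : ℝ → ℝ → Euc d) : ℝ≥0∞ :=
  ∫⁻ θ in Theta μ, ∫⁻ t in Set.Ici (0:ℝ),
    (mult μ χ (χ θ t)) ^ (α - 1) * (‖deriv (χ θ) t‖₊ : ℝ≥0∞)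

/-- `ρ(θ,x) = min_{t ≥ 0} |χ(θ,t) − x|`. -/
def pathInfDist {d : ℕ} (χ : ℝ → ℝ → Euc d) (θ : ℝ) (x : Euc d) : ℝ :=
  ⨅ t : Set.Ici (0:ℝ), dist (χ θ (t : ℝ)) x

/-- A mollifying kernel: a nonnegative, non-increasing, Lipschitz function on `ℝ₊`
with `J(0) = 1` and `J(r) → 0` as `r → ∞`. -/
def MollKernel (J : ℝ → ℝ) : Prop :=
  (∀ r, 0 ≤ r → 0 ≤ J r) ∧ AntitoneOn J (Set.Ici 0) ∧
    (∃ K : ℝ≥0, LipschitzOnWith K J (Set.Ici 0)) ∧ J 0 = 1 ∧ Tendsto J atTop (𝓝 0)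

/-- The mollified multiplicity `W_ε(x,χ) = ∫_Θ J_ε(min_{t≥0} |χ(θ,t) − x|) dθ`. -/
def Wmol {d : ℕ} (μ : Measure (Euc d)) (J : ℝ → ℝ) (ε : ℝ) (χ : ℝ → ℝ → Euc d)
    (x : Euc d) : ℝ≥0∞ :=
  ∫⁻ θ in Theta μ, ENNReal.ofReal (J (pathInfDist χ θ x / ε))

/-- The mollified irrigation cost `E^α_ε(χ)`. -/
def Emol {d : ℕ} (μ : Measure (Euc d)) (J : ℝ → ℝ) (α ε : ℝ)
    (χ : ℝ → ℝ → Euc d) : ℝ≥0∞ :=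
  ∫⁻ θ in Theta μ, ∫⁻ t in Set.Ici (0:ℝ),
    (Wmol μ J ε χ (χ θ t)) ^ (α - 1) * (‖deriv (χ θ) t‖₊ : ℝ≥0∞)

/-- The distance `d(γ₀,γ₁) = sup_{k ≥ 1} (1/k) ‖γ₀ − γ₁‖_{L^∞([0,k])}` between paths. -/
def dPath {d : ℕ} (γ₀ γ₁ : ℝ → Euc d) : ℝ :=
  ⨆ k : ℕ+, (1 / ((k : ℕ) : ℝ)) *
    ⨆ t : Set.Icc (0:ℝ) ((k : ℕ) : ℝ), dist (γ₀ (t : ℝ)) (γ₁ (t : ℝ))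

/-- Convergence `χ_n → χ` of irrigation plans: `d(χ_n(θ,·), χ(θ,·)) → 0` for a.e. `θ ∈ Θ`. -/
def PlansTendsto {d : ℕ} (μ : Measure (Euc d)) (χs : ℕ → ℝ → ℝ → Euc d)
    (χ : ℝ → ℝ → Euc d) : Prop :=
  ∀ᵐ θ ∂(volume.restrict (Theta μ)),
    Tendsto (fun n => dPath (χs n θ) (χ θ)) atTop (𝓝 0)

/-- The plan `χ` is parameterized by arc-length: for a.e. `t`, `|∂_t χ(θ,t)| = 1` for
`0 < t < T(θ)` and `|∂_t χ(θ,t)| = 0` for `t > T(θ)`. -/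
def ArcLength {d : ℕ} (μ : Measure (Euc d)) (χ : ℝ → ℝ → Euc d) : Prop :=
  ∀ θ ∈ Theta μ, ∀ᵐ t ∂(volume : Measure ℝ),
    (0 < t → t < stopTime χ θ → ‖deriv (χ θ) t‖ = 1) ∧
    (stopTime χ θ < t → ‖deriv (χ θ) t‖ = 0)

/-- An alternative mollifying kernel: smooth, positive, strictly decreasing on `ℝ₊`,
with `1 ≤ ∫₀^∞ J(r) dr < ∞`. -/
def MollKernel2 (J : ℝ → ℝ) : Prop :=
  ContDiffOn ℝ (⊤ : ℕ∞) J (Set.Ici 0) ∧ (∀ r, 0 ≤ r → 0 < J r) ∧ StrictAntiOn J (Set.Ici 0) ∧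
    IntegrableOn J (Set.Ioi 0) volume ∧ 1 ≤ ∫ r in Set.Ioi (0:ℝ), J r

/-- The alternative mollified multiplicity
`W̃_ε(x,χ) = ∫_Θ min{1, ∫₀^∞ (1/ε) J_ε(|χ(θ,t) − x|) |∂_t χ(θ,t)| dt} dθ`. -/
def Wtil {d : ℕ} (μ : Measure (Euc d)) (J : ℝ → ℝ) (ε : ℝ) (χ : ℝ → ℝ → Euc d)
    (x : Euc d) : ℝ≥0∞ :=
  ∫⁻ θ in Theta μ,
    min 1 (∫⁻ t in Set.Ici (0:ℝ),
      ENNReal.ofReal ((1 / ε) * J (dist (χ θ t) x / ε)) * (‖deriv (χ θ) t‖₊ : ℝ≥0∞))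

/-- The alternative mollified irrigation cost `Ẽ^α_ε(χ)`. -/
def Etil {d : ℕ} (μ : Measure (Euc d)) (J : ℝ → ℝ) (α ε : ℝ)
    (χ : ℝ → ℝ → Euc d) : ℝ≥0∞ :=
  ∫⁻ θ in Theta μ, ∫⁻ t in Set.Ici (0:ℝ),
    (Wtil μ J ε χ (χ θ t)) ^ (α - 1) * (‖deriv (χ θ) t‖₊ : ℝ≥0∞)


lemma tendsto_mul_of_mollKernel2 {J : ℝ → ℝ} (hJ : MollKernel2 J) :
    Tendsto (fun r => r * J r) atTop (𝓝 0) := by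
  obtain ⟨-, hpos, hanti, hint, -⟩ := hJ
  have h1 : Tendsto (fun r : ℝ => ∫ x in (0:ℝ)..r, J x) atTop (𝓝 (∫ x in Set.Ioi 0, J x)) :=
    intervalIntegral_tendsto_integral_Ioi 0 hint tendsto_id
  have h2 : Tendsto (fun r : ℝ => ∫ x in (0:ℝ)..(r / 2), J x) atTop
      (𝓝 (∫ x in Set.Ioi 0, J x)) :=
    intervalIntegral_tendsto_integral_Ioi 0 hint (tendsto_id.atTop_div_const two_pos)
  have h3 := (h1.sub h2).const_mul 2
  rw [sub_self, mul_zero] at h3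
  refine tendsto_of_tendsto_of_tendsto_of_le_of_le' tendsto_const_nhds h3 ?_ ?_
  · filter_upwards [eventually_ge_atTop 0] with r hr
    exact mul_nonneg hr (hpos r hr).le
  · filter_upwards [eventually_gt_atTop 0] with r hr
    have hii : ∀ a b : ℝ, 0 ≤ a → a ≤ b → IntervalIntegrable J volume a b := by
      intro a b ha hab
      rw [intervalIntegrable_iff_integrableOn_Ioc_of_le hab]
      exact hint.mono_set fun x hx => lt_of_le_of_lt ha hx.1
    rw [intervalIntegral.integral_interval_sub_left (hii 0 r le_rfl hr.le)
      (hii 0 (r / 2) le_rfl (by linarith))]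
    have h4 : ∫ x in (r / 2)..r, J r ≤ ∫ x in (r / 2)..r, J x := by
      refine intervalIntegral.integral_mono_on (by linarith) (by simp)
        (hii _ _ (by linarith) (by linarith)) fun x hx => ?_
      exact hanti.antitoneOn (Set.mem_Ici.2 (by linarith [hx.1])) (Set.mem_Ici.2 hr.le) hx.2
    rw [intervalIntegral.integral_const, smul_eq_mul] at h4
    linarith

lemma tendsto_mollKernel2_rescaled {J : ℝ → ℝ} (hJ : MollKernel2 J) {εs : ℕ → ℝ}
    (hεs : ∀ n, 0 < εs n) (hεs0 : Tendsto εs atTop (𝓝 0)) {δ : ℝ} (hδ : 0 < δ) :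
    Tendsto (fun n => 1 / εs n * J (δ / εs n)) atTop (𝓝 0) := by
  have h1 : Tendsto (fun n => δ / εs n) atTop atTop := by
    have h2 : Tendsto εs atTop (𝓝[>] 0) :=
      tendsto_nhdsWithin_iff.2 ⟨hεs0, Eventually.of_forall hεs⟩
    exact h2.inv_tendsto_nhdsGT_zero.const_mul_atTop hδ
  have h3 := ((tendsto_mul_of_mollKernel2 hJ).comp h1).const_mul δ⁻¹
  rw [mul_zero] at h3
  refine h3.congr fun n => ?_
  have := (hεs n).ne'
  simp only [Function.comp]
  field_simp

/-- Paths at distance `dPath` apart are uniformly close on bounded time intervals. -/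
lemma dist_le_mul_dPath {d : ℕ} {γ₀ γ₁ : ℝ → Euc d} (h₀ : LipschitzWith 1 γ₀)
    (h₁ : LipschitzWith 1 γ₁) (h : γ₀ 0 = γ₁ 0) (k : ℕ+) {t : ℝ}
    (ht : t ∈ Set.Icc (0:ℝ) ((k : ℕ) : ℝ)) :
    dist (γ₀ t) (γ₁ t) ≤ ((k : ℕ) : ℝ) * dPath γ₀ γ₁ := by
  have hb : ∀ s : ℝ, 0 ≤ s → dist (γ₀ s) (γ₁ s) ≤ 2 * s := by
    intro s hs
    have e0 := h₀.dist_le_mul s 0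
    have e1 := h₁.dist_le_mul 0 s
    rw [Real.dist_eq, sub_zero, abs_of_nonneg hs] at e0
    rw [Real.dist_eq, zero_sub, abs_neg, abs_of_nonneg hs] at e1
    have := dist_triangle4 (γ₀ s) (γ₀ 0) (γ₁ 0) (γ₁ s)
    rw [h, dist_self] at this
    rw [h] at e0
    simp only [NNReal.coe_one, one_mul] at e0 e1
    linarith
  have hk : ∀ j : ℕ+, (0:ℝ) < ((j : ℕ) : ℝ) := fun j => Nat.cast_pos.2 j.pos
  have hbdd : ∀ j : ℕ+, BddAbove (Set.range
      fun s : Set.Icc (0:ℝ) ((j : ℕ) : ℝ) => dist (γ₀ (s : ℝ)) (γ₁ (s : ℝ))) := by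
    rintro j
    refine ⟨2 * (j : ℕ), ?_⟩
    rintro _ ⟨s, rfl⟩
    exact (hb s s.2.1).trans (by linarith [s.2.2])
  have hbdd' : BddAbove (Set.range fun j : ℕ+ => (1 / ((j : ℕ) : ℝ)) *
      ⨆ s : Set.Icc (0:ℝ) ((j : ℕ) : ℝ), dist (γ₀ (s : ℝ)) (γ₁ (s : ℝ))) := by
    refine ⟨2, ?_⟩
    rintro _ ⟨j, rfl⟩
    have : Nonempty (Set.Icc (0:ℝ) ((j : ℕ) : ℝ)) := ⟨⟨0, le_rfl, (hk j).le⟩⟩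
    have h2 : ⨆ s : Set.Icc (0:ℝ) ((j : ℕ) : ℝ), dist (γ₀ (s : ℝ)) (γ₁ (s : ℝ))
        ≤ 2 * ((j : ℕ) : ℝ) :=
      ciSup_le fun s => (hb s s.2.1).trans (by linarith [s.2.2])
    change 1 / ((j : ℕ) : ℝ) * _ ≤ 2
    rw [one_div, inv_mul_le_iff₀ (hk j)]
    linarith
  have h3 := le_ciSup (hbdd k) ⟨t, ht⟩
  have h4 := le_ciSup hbdd' k
  change 1 / ((k : ℕ) : ℝ) * _ ≤ dPath γ₀ γ₁ at h4
  rw [one_div, inv_mul_le_iff₀ (hk k)] at h4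
  exact h3.trans h4

/-- The particles still moving after time `k`. -/
def movingAfter {d : ℕ} (χ : ℝ → ℝ → Euc d) (k : ℝ) : Set ℝ :=
  {θ | ∃ q : ℚ, k ≤ q ∧ χ θ q ≠ χ θ k}

/-- The mollified length of the path `χ θ` near `x`, up to time `k`, computed as though the path
had unit speed. -/
def truncLength {d : ℕ} (J : ℝ → ℝ) (ε k : ℝ) (χ : ℝ → ℝ → Euc d) (x : Euc d) (θ : ℝ) : ℝ≥0∞ :=
  ∫⁻ t in Set.Icc 0 k, ENNReal.ofReal ((1 / ε) * J (dist (χ θ t) x / ε))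

section Plan

variable {d : ℕ} {μ : Measure (Euc d)} {χ : ℝ → ℝ → Euc d}

lemma measurableSet_Theta : MeasurableSet (Theta μ) := measurableSet_Icc

lemma IsIrrigPlan.measurable_eval (hχ : IsIrrigPlan μ χ) (t : ℝ) : Measurable fun θ => χ θ t :=
  hχ.measurable.comp (measurable_id.prodMk measurable_const)

lemma IsIrrigPlan.measurableSet_movingAfter (hχ : IsIrrigPlan μ χ) (k : ℝ) :
    MeasurableSet (movingAfter χ k) := by
  have : movingAfter χ k = ⋃ q : ℚ, {θ | k ≤ q ∧ χ θ q ≠ χ θ k} := by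
    ext θ
    simp [movingAfter]
  rw [this]
  refine MeasurableSet.iUnion fun q => (MeasurableSet.const _).inter ?_
  exact (measurableSet_eq_fun (hχ.measurable_eval _) (hχ.measurable_eval _)).compl

lemma IsIrrigPlan.le_stopTime (hχ : IsIrrigPlan μ χ) {θ k : ℝ} (hθ : θ ∈ Theta μ)
    (h : θ ∈ movingAfter χ k) : k ≤ stopTime χ θ := by
  obtain ⟨q, hq, hne⟩ := h
  refine le_csInf (hχ.eventuallyConst θ hθ) ?_
  rintro t ⟨-, ht⟩
  by_contra! hlt
  exact hne ((ht q (hlt.le.trans hq)).trans (ht k hlt.le).symm)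

lemma IsIrrigPlan.deriv_eq_zero (hχ : IsIrrigPlan μ χ) {θ k t : ℝ} (hθ : θ ∈ Theta μ)
    (h : θ ∉ movingAfter χ k) (ht : k < t) : deriv (χ θ) t = 0 := by
  have hc := (hχ.lipschitz θ hθ).continuous
  have hq : ∀ q : ℚ, k ≤ q → χ θ q = χ θ k := by
    intro q hq
    by_contra hne
    exact h ⟨q, hq, hne⟩
  have hsub : Set.Ioi k ⊆ {s | χ θ s = χ θ k} := by
    have hcl : IsClosed {s | χ θ s = χ θ k} := isClosed_eq hc continuous_const
    refine (Rat.isDenseEmbedding_coe_real.dense.open_subset_closure_inter isOpen_Ioi).trans ?_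
    refine closure_minimal ?_ hcl
    rintro _ ⟨hs, q, rfl⟩
    exact hq q (le_of_lt hs)
  have he : χ θ =ᶠ[𝓝 t] fun _ => χ θ k := by
    filter_upwards [isOpen_Ioi.mem_nhds ht] with s hs using hsub hs
  rw [he.deriv_eq, deriv_const]

lemma IsIrrigPlan.volume_movingAfter_le (hχ : IsIrrigPlan μ χ) {C k : ℝ} (hk : 0 < k)
    (hT : ∫⁻ θ in Theta μ, ENNReal.ofReal (stopTime χ θ) ≤ ENNReal.ofReal C) :
    volume.restrict (Theta μ) (movingAfter χ k) ≤ ENNReal.ofReal (C / k) := by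
  have hk' : ENNReal.ofReal k ≠ 0 := by simpa using hk
  rw [ENNReal.ofReal_div_of_pos hk, ENNReal.le_div_iff_mul_le (.inl hk')
    (.inl ENNReal.ofReal_ne_top), mul_comm,
    ← lintegral_indicator_const (hχ.measurableSet_movingAfter k)]
  refine le_trans (setLIntegral_mono' measurableSet_Theta fun θ hθ => ?_) hT
  by_cases h : θ ∈ movingAfter χ k
  · rw [Set.indicator_of_mem h]
    exact ENNReal.ofReal_le_ofReal (hχ.le_stopTime hθ h)
  · rw [Set.indicator_of_notMem h]
    exact zero_le

lemma IsIrrigPlan.measurable_truncLength (hχ : IsIrrigPlan μ χ) {J : ℝ → ℝ}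
    (hJ : MollKernel2 J) {ε : ℝ} (hε : 0 < ε) (k : ℝ) (x : Euc d) :
    Measurable (truncLength J ε k χ x) := by
  have hJm : Measurable fun r : ℝ => J (max r 0) := by
    refine Antitone.measurable fun a b hab => ?_
    exact hJ.2.2.1.antitoneOn (Set.mem_Ici.2 (le_max_right _ _))
      (Set.mem_Ici.2 (le_max_right _ _)) (max_le_max_right _ hab)
  have hm : Measurable fun p : ℝ × ℝ =>
      ENNReal.ofReal ((1 / ε) * J (max (dist (χ p.1 p.2) x / ε) 0)) :=
    ((hJm.comp ((hχ.measurable.dist measurable_const).div_const ε)).const_mul _).ennreal_ofReal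
  have h := Measurable.lintegral_prod_right' (ν := volume.restrict (Set.Icc 0 k)) hm
  convert h using 1
  funext θ
  refine lintegral_congr fun t => ?_
  rw [max_eq_left (div_nonneg dist_nonneg hε.le)]

lemma IsIrrigPlan.wtil_le (hχ : IsIrrigPlan μ χ) {J : ℝ → ℝ} (ε k : ℝ) (x : Euc d) :
    Wtil μ J ε χ x ≤ volume.restrict (Theta μ) (movingAfter χ k) +
      ∫⁻ θ in Theta μ, min 1 (truncLength J ε k χ x θ) := by
  have hA := hχ.measurableSet_movingAfter k
  rw [← lintegral_indicator_one hA,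
    ← lintegral_add_left (measurable_one.indicator hA)]
  refine setLIntegral_mono' measurableSet_Theta fun θ hθ => ?_
  by_cases h : θ ∈ movingAfter χ k
  · rw [Set.indicator_of_mem h]
    exact (min_le_left _ _).trans le_self_add
  · rw [Set.indicator_of_notMem h, zero_add]
    refine min_le_min_left _ ?_
    unfold truncLength
    rw [← lintegral_indicator measurableSet_Icc, ← lintegral_indicator measurableSet_Ici]
    refine lintegral_mono fun t => ?_
    by_cases h0 : t ∈ Set.Ici (0:ℝ)
    · rw [Set.indicator_of_mem h0]
      rcases le_or_gt t k with htk | htk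
      · rw [Set.indicator_of_mem (Set.mem_Icc.2 ⟨h0, htk⟩)]
        refine mul_le_of_le_one_right' ?_
        have := norm_deriv_le_of_lipschitz (x₀ := t) (hχ.lipschitz θ hθ)
        rw [ENNReal.coe_le_one_iff]
        exact_mod_cast this
      · simp [hχ.deriv_eq_zero hθ h htk]
    · rw [Set.indicator_of_notMem h0]
      exact zero_le

end Plan

/-- Along paths converging to one that avoids `x`, the truncated mollified lengths near points
converging to `x` vanish. -/
lemma tendsto_truncLength_zero {d : ℕ} {J : ℝ → ℝ} (hJ : MollKernel2 J) {εs : ℕ → ℝ}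
    (hεs : ∀ n, 0 < εs n) (hεs0 : Tendsto εs atTop (𝓝 0))
    {χs : ℕ → ℝ → ℝ → Euc d} {χ : ℝ → ℝ → Euc d} {θ : ℝ}
    (hχs : ∀ n, LipschitzWith 1 (χs n θ)) (hχ : LipschitzWith 1 (χ θ))
    (hinit : ∀ n, χs n θ 0 = χ θ 0)
    (hconv : Tendsto (fun n => dPath (χs n θ) (χ θ)) atTop (𝓝 0))
    {xs : ℕ → Euc d} {x : Euc d} (hx : Tendsto xs atTop (𝓝 x))
    (hne : ∀ t, 0 ≤ t → χ θ t ≠ x) (k : ℕ+) :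
    Tendsto (fun n => truncLength J (εs n) (k : ℕ) (χs n) (xs n) θ) atTop (𝓝 0) := by
  have hk : (0:ℝ) < ((k : ℕ) : ℝ) := Nat.cast_pos.2 k.pos
  obtain ⟨t₀, ht₀, hmin⟩ := (isCompact_Icc (a := (0:ℝ)) (b := ((k : ℕ) : ℝ))).exists_isMinOn
    (Set.nonempty_Icc.2 hk.le) (hχ.continuous.dist continuous_const (g := fun _ => x)).continuousOn
  set δ := dist (χ θ t₀) x with hδdef
  have hδ : 0 < δ := dist_pos.2 (hne t₀ ht₀.1)
  have h1 : Tendsto (fun n => ENNReal.ofReal (1 / εs n * J (δ / 2 / εs n)) *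
      volume (Set.Icc (0:ℝ) ((k : ℕ) : ℝ))) atTop (𝓝 0) := by
    have h2 := ENNReal.tendsto_ofReal
      (tendsto_mollKernel2_rescaled hJ hεs hεs0 (half_pos hδ))
    have h3 := ENNReal.Tendsto.mul_const (b := volume (Set.Icc (0:ℝ) ((k : ℕ) : ℝ))) h2
      (.inr (by simp))
    simpa using h3
  refine tendsto_of_tendsto_of_tendsto_of_le_of_le' tendsto_const_nhds h1
    (Eventually.of_forall fun _ => zero_le) ?_
  have h4 := hconv.const_mul ((k : ℕ) : ℝ)
  rw [mul_zero] at h4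
  have h5 : Tendsto (fun n => dist (xs n) x) atTop (𝓝 0) := tendsto_iff_dist_tendsto_zero.1 hx
  filter_upwards [h4.eventually_lt_const (show (0:ℝ) < δ / 4 by linarith),
    h5.eventually_lt_const (show (0:ℝ) < δ / 4 by linarith)] with n h6 h7
  unfold truncLength
  rw [← setLIntegral_const]
  refine setLIntegral_mono' measurableSet_Icc fun t ht => ?_
  refine ENNReal.ofReal_le_ofReal (mul_le_mul_of_nonneg_left ?_ (one_div_pos.2 (hεs n)).le)
  have hεn := hεs n
  refine hJ.2.2.1.antitoneOn (Set.mem_Ici.2 (by positivity)) (Set.mem_Ici.2 (by positivity)) ?_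
  refine div_le_div_of_nonneg_right ?_ hεn.le
  have h8 := dist_le_mul_dPath (hχs n) hχ (hinit n) k ht
  have h9 : δ ≤ dist (χ θ t) x := hmin ht
  have h10 := dist_triangle4 (χ θ t) (χs n θ t) (xs n) x
  rw [dist_comm (χ θ t) (χs n θ t)] at h10
  linarith

/-- upper semicontinuity of the alternative mollified multiplicities
along plans `χ_n → χ` with mollification parameters `ε_n → 0`. -/
theorem alt_mollified_mult_limsup_le_mult {d : ℕ} (hd : 1 ≤ d)
    (μ : Measure (Euc d)) [IsFiniteMeasure μ]
    (hsupp : ∃ R : ℝ, μ (Metric.closedBall 0 R)ᶜ = 0)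
    (J : ℝ → ℝ) (hJ : MollKernel2 J)
    (εs : ℕ → ℝ) (hεs : ∀ n, 0 < εs n) (hεs0 : Tendsto εs atTop (𝓝 0))
    (χs : ℕ → ℝ → ℝ → Euc d) (χ : ℝ → ℝ → Euc d)
    (hχs : ∀ n, IsIrrigPlan μ (χs n)) (hχ : IsIrrigPlan μ χ)
    (hconv : PlansTendsto μ χs χ)
    (C : ℝ) (hC : 0 < C)
    (hT : ∀ n, ∫⁻ θ in Theta μ, ENNReal.ofReal (stopTime (χs n) θ) ≤ ENNReal.ofReal C) :
    ∀ᵐ θ ∂(volume.restrict (Theta μ)), ∀ t : ℝ, 0 ≤ t →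
      Filter.limsup (fun n => Wtil μ J (εs n) (χs n) (χs n θ t)) atTop
        ≤ mult μ χ (χ θ t) := by
  filter_upwards [hconv, ae_restrict_mem measurableSet_Theta] with θ₀ hθ₀ hmem t ht
  have hx : Tendsto (fun n => χs n θ₀ t) atTop (𝓝 (χ θ₀ t)) := by
    obtain ⟨m, hm⟩ := exists_nat_ge t
    have h1 := hθ₀.const_mul (((Nat.succPNat m : ℕ+) : ℕ) : ℝ)
    rw [mul_zero] at h1
    refine tendsto_iff_dist_tendsto_zero.2 (squeeze_zero (fun _ => dist_nonneg) (fun n => ?_) h1)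
    refine dist_le_mul_dPath ((hχs n).lipschitz _ hmem) (hχ.lipschitz _ hmem)
      (((hχs n).init _ hmem).trans (hχ.init _ hmem).symm) _ ⟨ht, ?_⟩
    rw [Nat.succPNat_coe]
    push_cast
    linarith
  set x := χ θ₀ t
  set S : Set ℝ := {θ | ∃ s, 0 ≤ s ∧ χ θ s = x}
  have hS : volume.restrict (Theta μ) S = mult μ χ x := by
    rw [Measure.restrict_apply' measurableSet_Theta, Set.inter_comm]
    rfl
  have hfin : volume (Theta μ) ≠ ∞ := by simp [Theta]
  have key : ∀ m : ℕ, limsup (fun n => Wtil μ J (εs n) (χs n) (χs n θ₀ t)) atTop ≤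
      ENNReal.ofReal (C / (m + 1 : ℕ)) + mult μ χ x := by
    intro m
    set k : ℕ+ := Nat.succPNat m
    have hk : (0:ℝ) < ((k : ℕ) : ℝ) := Nat.cast_pos.2 k.pos
    set g : ℕ → ℝ → ℝ≥0∞ := fun n θ =>
      min 1 (truncLength J (εs n) (k : ℕ) (χs n) (χs n θ₀ t) θ)
    have hle : ∀ n, Wtil μ J (εs n) (χs n) (χs n θ₀ t) ≤
        ENNReal.ofReal (C / (k : ℕ)) + ∫⁻ θ in Theta μ, g n θ := fun n =>
      ((hχs n).wtil_le (εs n) (k : ℕ) _).trans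
        (add_le_add_left ((hχs n).volume_movingAfter_le hk (hT n)) _)
    have hg : limsup (fun n => ∫⁻ θ in Theta μ, g n θ) atTop ≤ mult μ χ x := by
      refine (limsup_lintegral_le (fun _ => 1)
        (fun n => measurable_const.min ((hχs n).measurable_truncLength hJ (hεs n) _ _))
        (fun n => Eventually.of_forall fun θ => min_le_left _ _) (by simpa using hfin)).trans ?_
      rw [← hS]
      refine le_trans (lintegral_mono_ae ?_) (lintegral_indicator_one_le S)
      filter_upwards [hconv, ae_restrict_mem measurableSet_Theta] with θ hθ hθm
      by_cases hθS : θ ∈ S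
      · rw [Set.indicator_of_mem hθS]
        exact limsup_le_of_le (by isBoundedDefault)
          (Eventually.of_forall fun n => min_le_left _ _)
      · have h2 := tendsto_truncLength_zero hJ hεs hεs0 (fun n => (hχs n).lipschitz θ hθm)
          (hχ.lipschitz θ hθm) (fun n => ((hχs n).init θ hθm).trans (hχ.init θ hθm).symm) hθ hx
          (fun s hs h => hθS ⟨s, hs, h⟩) k
        rw [Set.indicator_of_notMem hθS]
        refine (limsup_le_limsup (Eventually.of_forall fun n => ?_)).trans h2.limsup_eq.le
        exact min_le_right _ _
    calc limsup (fun n => Wtil μ J (εs n) (χs n) (χs n θ₀ t)) atTop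
        ≤ limsup (fun n => ENNReal.ofReal (C / (k : ℕ)) + ∫⁻ θ in Theta μ, g n θ) atTop :=
          limsup_le_limsup (Eventually.of_forall hle)
      _ = ENNReal.ofReal (C / (k : ℕ)) + limsup (fun n => ∫⁻ θ in Theta μ, g n θ) atTop :=
          limsup_const_add _ _ _ (by isBoundedDefault) (by isBoundedDefault)
      _ ≤ _ := add_le_add_right hg _
  have hlim : Tendsto (fun m : ℕ => ENNReal.ofReal (C / (m + 1 : ℕ)) + mult μ χ x) atTop
      (𝓝 (mult μ χ x)) := by
    have h1 : Tendsto (fun m : ℕ => C / ((m + 1 : ℕ) : ℝ)) atTop (𝓝 0) :=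
      (tendsto_const_div_atTop_nhds_zero_nat C).comp (tendsto_add_atTop_nat 1)
    simpa using (ENNReal.tendsto_ofReal h1).add_const (mult μ χ x)
  exact ge_of_tendsto' hlim key

end
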